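/- Let n > 4 and let h ∈ S_n be an n-cycle. (1) If n is odd, then the maximum of χ(h)/χ(1) over all irreducible complex characters χ of S_n with χ(1) ≠ 1 equals 2/((n−1)(n−2)); consequently the corresponding eigenvalue |H|·2/((n−1)(n−2)) of H⁺, where H is the conjugacy class of h, equals 2·(n−3)!. (2) If n is even, then this maximum equals 1/(n−1), and the corresponding eigenvalue of H⁺ equals (n−2)!. -/

import Mathlib

open Equiv

open Classical in
/-- The cycles with support exactly `s`. -/
noncomputable def cyclesOn {α : Type*} [Fintype α] [DecidableEq α] (s : Finset α) :
    Finset (Perm α) :=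
  {g | g.IsCycle ∧ g.support = s}

theorem mem_cyclesOn {α : Type*} [Fintype α] [DecidableEq α] {s : Finset α} {g : Perm α} :
    g ∈ cyclesOn s ↔ g.IsCycle ∧ g.support = s := by
  simp [cyclesOn]

theorem sum_cyclesOn_insert {α M : Type*} [Fintype α] [DecidableEq α] [AddCommMonoid M]
    (f : Perm α → M) {s : Finset α} {a : α} (ha : a ∉ s) (hs : 2 ≤ s.card) :
    ∑ g ∈ cyclesOn (insert a s), f g =
      ∑ i ∈ s, ∑ g ∈ cyclesOn s, f (swap i a * g) := by
  rw [← Finset.sum_product']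
  symm
  refine Finset.sum_bij' (fun p _ => swap p.1 a * p.2) (fun g _ => (g a, swap (g a) a * g))
    ?_ ?_ ?_ ?_ ?_
  · rintro ⟨i, g⟩ hp
    simp only [Finset.mem_product, mem_cyclesOn] at hp ⊢
    obtain ⟨hi, hg, hgs⟩ := hp
    have hig : i ∈ g.support := hgs ▸ hi
    have hform : (g.toList i).formPerm = g := by
      rw [Perm.formPerm_toList, hg.cycleOf_eq (Perm.mem_support.1 hig)]
    have hmem : ∀ y, y ∈ g.toList i ↔ y ∈ s := by
      intro y
      rw [Perm.mem_toList_iff, ← hgs]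
      constructor
      · rintro ⟨h, h'⟩
        exact (h.mem_support_iff).1 h'
      · intro h
        exact ⟨hg.sameCycle (Perm.mem_support.1 hig) (Perm.mem_support.1 h), hig⟩
    have hnd := Perm.nodup_toList g i
    obtain ⟨l, hl⟩ : ∃ l, g.toList i = i :: l := by
      have h0 := Perm.toList_getElem_zero g i hig
      cases h : g.toList i with
      | nil => simp [Perm.toList_eq_nil_iff, hig] at h
      | cons b l => simp [h] at h0; exact ⟨l, by rw [h0]⟩
    have key : swap i a * g = (a :: i :: l).formPerm := by
      rw [List.formPerm_cons_cons, ← hl, hform, swap_comm]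
    have hnd' : (a :: i :: l).Nodup := by
      rw [← hl, List.nodup_cons, hmem]
      exact ⟨ha, hnd⟩
    rw [key]
    refine ⟨List.isCycle_formPerm hnd' (by simp), ?_⟩
    rw [List.support_formPerm_of_nodup _ hnd' (by simp), ← hl]
    ext y
    simp [hmem]
  · intro g hg
    simp only [Finset.mem_product, mem_cyclesOn] at hg ⊢
    obtain ⟨hg, hgs⟩ := hg
    have haa : g a ≠ a := by
      rw [← Perm.mem_support, hgs]; simp
    have haaa : g (g a) ≠ a := by
      intro h
      have hsub : g.support ⊆ {a, g a} := by
        intro y hy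
        obtain ⟨i, rfl⟩ := hg.exists_pow_eq haa (Perm.mem_support.1 hy)
        clear hy
        induction i with
        | zero => simp
        | succ i ih =>
          rw [pow_succ', Perm.mul_apply]
          simp only [Finset.mem_insert, Finset.mem_singleton] at ih ⊢
          rcases ih with ih | ih <;> rw [ih] <;> simp [h]
      have h1 := Finset.card_le_card hsub
      rw [hgs, Finset.card_insert_of_notMem ha] at h1
      have := Finset.card_le_two (a := a) (b := g a)
      omega
    have hga : g a ∈ s := by
      have : g a ∈ g.support := by simpa using haa
      rw [hgs] at this
      simpa [haa] using this
    refine ⟨hga, ?_, ?_⟩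
    · rw [swap_comm]; exact hg.swap_mul haa haaa
    · rw [swap_comm, Perm.support_swap_mul_eq _ _ haaa, hgs]
      ext y
      simp only [Finset.mem_sdiff, Finset.mem_insert, Finset.mem_singleton]
      constructor
      · tauto
      · intro h
        exact ⟨Or.inr h, fun h' => ha (h' ▸ h)⟩
  · rintro ⟨i, g⟩ hp
    simp only [Finset.mem_product, mem_cyclesOn] at hp ⊢
    have : g a = a := by
      rw [← Perm.notMem_support, hp.2.2]; exact ha
    simp [this]
  · intro g hg
    simp
  · intro p hp
    rfl

theorem cyclesOn_pair {α : Type*} [Fintype α] [DecidableEq α] {a b : α}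
    (hab : a ≠ b) :
    cyclesOn {a, b} = {swap a b} := by
  ext g
  simp only [mem_cyclesOn, Finset.mem_singleton]
  constructor
  · rintro ⟨-, hs⟩
    have : g.support.card = 2 := by rw [hs, Finset.card_pair hab]
    obtain ⟨x, y, hxy, rfl⟩ := Perm.card_support_eq_two.1 this
    rw [Perm.support_swap hxy] at hs
    have hx : x ∈ ({a, b} : Finset α) := by rw [← hs]; simp
    have hy : y ∈ ({a, b} : Finset α) := by rw [← hs]; simp
    simp only [Finset.mem_insert, Finset.mem_singleton] at hx hy
    rcases hx with rfl | rfl <;> rcases hy with rfl | rfl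
    · exact absurd rfl hxy
    · rfl
    · rw [swap_comm]
    · exact absurd rfl hxy
  · rintro rfl
    exact ⟨Perm.isCycle_swap hab, Perm.support_swap hab⟩

/-- The action of the `k`-th Jucys–Murphy element `∑ i < k, (i k)`. -/
noncomputable def jucysMurphy {n : ℕ} {V : Type*} [AddCommGroup V] [Module ℂ V]
    (ρ : Representation ℂ (Perm (Fin n)) V) (k : Fin n) : Module.End ℂ V :=
  ∑ i ∈ Finset.Iio k, ρ (swap i k)

/-- The action of the sum of all full cycles. -/
noncomputable def sumCycles {n : ℕ} {V : Type*} [AddCommGroup V] [Module ℂ V]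
    (ρ : Representation ℂ (Perm (Fin n)) V) : Module.End ℂ V :=
  ∑ g ∈ cyclesOn (Finset.univ : Finset (Fin n)), ρ g

section
variable {n : ℕ} {V : Type*} [AddCommGroup V] [Module ℂ V]
    (ρ : Representation ℂ (Perm (Fin n)) V)

theorem sum_cycles_Iic_apply {v : V} {c : ℕ → ℂ}
    (hv : ∀ k : Fin n, jucysMurphy ρ k v = c k • v) (m : ℕ) (hm : m + 1 < n) :
    ∑ g ∈ cyclesOn (Finset.Iic (⟨m + 1, hm⟩ : Fin n)), ρ g v =
      (∏ j ∈ Finset.range (m + 1), c (j + 1)) • v := by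
  induction m with
  | zero =>
    have h1 : (Finset.Iic (⟨0 + 1, hm⟩ : Fin n)) = {⟨0, by omega⟩, ⟨1, hm⟩} := by
      ext x; simp [Fin.ext_iff, Fin.le_def]; omega
    have h2 : (Finset.Iio (⟨1, hm⟩ : Fin n)) = {⟨0, by omega⟩} := by
      ext x; simp [Fin.ext_iff, Fin.lt_def]
    have h3 := hv ⟨1, hm⟩
    rw [jucysMurphy, h2, Finset.sum_singleton] at h3
    rw [h1, cyclesOn_pair (by simp [Fin.ext_iff]), Finset.sum_singleton, h3]
    simp
  | succ m ih =>
    have h1 : (Finset.Iic (⟨m + 1 + 1, hm⟩ : Fin n)) =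
        insert ⟨m + 1 + 1, hm⟩ (Finset.Iic ⟨m + 1, by omega⟩) := by
      ext x; simp [Fin.ext_iff, Fin.le_def]; omega
    have h2 : (Finset.Iio (⟨m + 1 + 1, hm⟩ : Fin n)) = Finset.Iic ⟨m + 1, by omega⟩ := by
      ext x; simp [Fin.le_def, Fin.lt_def]
    have h3 := hv ⟨m + 1 + 1, hm⟩
    rw [jucysMurphy, h2, LinearMap.sum_apply] at h3
    rw [h1, sum_cyclesOn_insert _ (by simp [Fin.le_def]) (by simp)]
    simp only [map_mul, Module.End.mul_apply, ← map_sum]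
    rw [ih (by omega)]
    simp only [map_smul]
    rw [← Finset.smul_sum, h3, smul_smul, Finset.prod_range_succ _ (m + 1)]

theorem sumCycles_apply {v : V} {c : ℕ → ℂ} (hn : 2 ≤ n)
    (hv : ∀ k : Fin n, jucysMurphy ρ k v = c k • v) :
    sumCycles ρ v = (∏ j ∈ Finset.range (n - 1), c (j + 1)) • v := by
  obtain ⟨m, rfl⟩ : ∃ m, n = m + 2 := ⟨n - 2, by omega⟩
  have h := sum_cycles_Iic_apply ρ hv m (by omega)
  have h1 : (Finset.Iic (⟨m + 1, by omega⟩ : Fin (m + 2))) = Finset.univ := by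
    ext x; simp [Fin.le_def]; omega
  rw [h1] at h
  rw [sumCycles, LinearMap.sum_apply, h]
  rfl

end

/-- The `k`-th term of `c` extends the earlier terms by one step away from zero. -/
def ExtendsAt (c : ℕ → ℂ) (k : ℕ) : Prop :=
  (∃ ε : ℂ, (ε = 1 ∨ ε = -1) ∧ ∃ m : ℕ, c k = ε * (m + 1) ∧ ∃ j < k, c j = ε * m) ∧
    ∀ j < k, c j ≠ c k

theorem ExtendsAt.exists_eq_mul {c : ℕ → ℂ} {k m : ℕ} {ε : ℂ} (h : ExtendsAt c k)
    (hε : ε = 1 ∨ ε = -1) (hk : c k = ε * (m + 1)) : ∃ j < k, c j = ε * m := by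
  obtain ⟨⟨δ, hδ, p, hp, j, hj, hjp⟩, -⟩ := h
  refine ⟨j, hj, ?_⟩
  rw [hk] at hp
  rw [hjp]
  rcases hε with rfl | rfl <;> rcases hδ with rfl | rfl
  · linear_combination -hp
  · have h1 : ((m + 1 + (p + 1) : ℕ) : ℂ) = 0 := by push_cast; linear_combination hp
    have := Nat.cast_eq_zero.1 h1
    omega
  · have h1 : ((m + 1 + (p + 1) : ℕ) : ℂ) = 0 := by push_cast; linear_combination -hp
    have := Nat.cast_eq_zero.1 h1
    omega
  · linear_combination -hp

theorem extendsAt_of_swap_closed {n : ℕ} {S : Set (ℕ → ℂ)}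
    (h0 : ∀ c ∈ S, c 0 = 0)
    (hnz : ∀ c ∈ S, ∀ k, 0 < k → k < n → c k ≠ 0)
    (hne : ∀ c ∈ S, ∀ k, k + 1 < n → c (k + 1) ≠ c k)
    (hsw : ∀ c ∈ S, ∀ k, k + 1 < n → c (k + 1) ≠ c k + 1 → c (k + 1) ≠ c k - 1 →
      c ∘ swap k (k + 1) ∈ S)
    (hbr : ∀ c ∈ S, ∀ k, k + 2 < n → (c (k + 1) = c k + 1 ∨ c (k + 1) = c k - 1) →
      c (k + 2) ≠ c k)
    (k : ℕ) (hk0 : 0 < k) (hkn : k < n) (c : ℕ → ℂ) (hc : c ∈ S) : ExtendsAt c k := by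
  induction k using Nat.strong_induction_on generalizing c with
  | _ k ih =>
  obtain ⟨r, rfl⟩ : ∃ r, k = r + 1 := ⟨k - 1, by omega⟩
  rcases Nat.eq_zero_or_pos r with rfl | hr
  · have h1 : c 1 = 1 ∨ c 1 = -1 := by
      by_contra! h
      have := hsw c hc 0 hkn (by simpa [h0 c hc] using h.1) (by simpa [h0 c hc] using h.2)
      have h2 := h0 _ this
      simp at h2
      exact hnz c hc 1 one_pos hkn h2
    refine ⟨⟨c 1, h1, 0, by simp, 0, by simp, by simp [h0 c hc]⟩, ?_⟩
    intro j hj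
    obtain rfl : j = 0 := by omega
    exact (hne c hc 0 hkn).symm
  have hpos : ∀ j, c j ≠ 0 → 0 < j := by
    intro j hj
    rcases Nat.eq_zero_or_pos j with rfl | h
    · exact absurd (h0 c hc) hj
    · exact h
  obtain ⟨⟨ε, hε, m, hm, j, hj, hjm⟩, hfresh⟩ := ih r (by omega) hr (by omega) c hc
  have hε0 : ε ≠ 0 := by rcases hε with rfl | rfl <;> norm_num
  by_cases hadj : c (r + 1) ≠ c r + 1 ∧ c (r + 1) ≠ c r - 1
  · obtain ⟨⟨δ, hδ, p, hp, i, hi, hip⟩, hf⟩ :=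
      ih r (by omega) hr (by omega) _ (hsw c hc r hkn hadj.1 hadj.2)
    have hsame : ∀ l < r, (c ∘ swap r (r + 1)) l = c l := by
      intro l hl
      simp [swap_apply_of_ne_of_ne (show l ≠ r by omega) (show l ≠ r + 1 by omega)]
    have hr' : (c ∘ swap r (r + 1)) r = c (r + 1) := by simp
    rw [hsame i hi] at hip
    rw [hr'] at hp
    refine ⟨⟨δ, hδ, p, hp, i, by omega, hip⟩, ?_⟩
    intro l hl
    rcases Nat.lt_succ_iff_lt_or_eq.1 hl with h | rfl
    · have := hf l h
      rwa [hsame l h, hr'] at this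
    · exact (hne c hc _ hkn).symm
  have hadj' : c (r + 1) = c r + ε ∨ c (r + 1) = c r - ε := by
    rw [not_and_or, not_not, not_not] at hadj
    rcases hε with rfl | rfl
    · exact hadj
    · rw [sub_neg_eq_add, ← sub_eq_add_neg]; exact hadj.symm
  rcases hadj' with hx | hx
  · have hx' : c (r + 1) = ε * ((m + 1 : ℕ) + 1) := by
      rw [hx, hm]; push_cast; ring
    refine ⟨⟨ε, hε, m + 1, hx', r, by omega, by rw [hm]; push_cast; ring⟩, ?_⟩
    intro l hl hlx
    rcases Nat.lt_succ_iff_lt_or_eq.1 hl with h | rfl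
    · rw [hx'] at hlx
      have hl0 : 0 < l := hpos l (by
        rw [hlx]; exact mul_ne_zero hε0 (by exact_mod_cast Nat.succ_ne_zero (m + 1)))
      obtain ⟨i, hi, hi'⟩ :=
        (ih l (by omega) hl0 (by omega) c hc).exists_eq_mul hε hlx
      exact hfresh i (by omega) (by rw [hi', hm]; push_cast; ring)
    · exact hne c hc _ hkn hlx.symm
  · exfalso
    have hxm : c (r + 1) = ε * m := by rw [hx, hm]; ring
    have hx0 := hnz c hc (r + 1) (by omega) hkn
    have hj0 : 0 < j := hpos j (by rwa [hjm, ← hxm])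
    rcases m with _ | p
    · exact hx0 (by simp [hxm])
    by_cases hjr : j + 1 = r
    · subst hjr
      refine hbr c hc j hkn ?_ (by rw [hxm, hjm])
      have : c (j + 1) = c j + ε := by rw [hm, hjm]; ring
      rcases hε with rfl | rfl
      · exact Or.inl this
      · right; rw [this]; ring
    obtain ⟨q, rfl⟩ : ∃ q, r = q + 1 := ⟨r - 1, by omega⟩
    have hjq : j < q := by omega
    have hq := ih q (by omega) (by omega) (by omega) c hc
    have hj' := ih j (by omega) hj0 (by omega) c hc
    have hzx : c q ≠ ε * (p + 1) := by
      intro h; exact hq.2 j hjq (by rw [hjm, h]; push_cast; ring)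
    have hzy : c q ≠ c (q + 1) := hfresh q (by omega)
    have hzy' : c q ≠ ε * (p + 3) := by
      intro h
      obtain ⟨i, hi, hi'⟩ := hq.exists_eq_mul hε
        (show c q = ε * ((p + 2 : ℕ) + 1) by rw [h]; push_cast; ring)
      exact hfresh i (by omega) (by rw [hi', hm]; push_cast; ring)
    have hzp : c q ≠ ε * p := by
      intro h
      obtain ⟨i, hi, hi'⟩ := hj'.exists_eq_mul (m := p) hε (by rw [hjm]; push_cast; ring)
      exact hq.2 i (by omega) (by rw [hi', h])
    have hc' : c ∘ swap q (q + 1) ∈ S := by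
      refine hsw c hc q (by omega) ?_ ?_ <;> rw [hm] <;> intro h
      · rcases hε with rfl | rfl
        · exact hzx (by push_cast at h; linear_combination -h)
        · exact hzy' (by push_cast at h; linear_combination -h)
      · rcases hε with rfl | rfl
        · exact hzy' (by push_cast at h; linear_combination -h)
        · exact hzx (by push_cast at h; linear_combination -h)
    have e1 : (c ∘ swap q (q + 1)) (q + 1) = c q := by simp
    have e2 : (c ∘ swap q (q + 1)) (q + 2) = c (q + 2) := by
      simp [swap_apply_of_ne_of_ne (show q + 2 ≠ q by omega) (show q + 2 ≠ q + 1 by omega)]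
    have hc'' : (c ∘ swap q (q + 1)) ∘ swap (q + 1) (q + 2) ∈ S := by
      rw [hm] at hzy
      refine hsw _ hc' (q + 1) (by omega) ?_ ?_ <;> rw [e1, e2, hxm] <;> intro h
      · rcases hε with rfl | rfl
        · exact hzp (by push_cast at h; linear_combination -h)
        · exact hzy (by push_cast at h ⊢; linear_combination -h)
      · rcases hε with rfl | rfl
        · exact hzy (by push_cast at h ⊢; linear_combination -h)
        · exact hzp (by push_cast at h; linear_combination -h)
    have hfin := (ih (q + 1) (by omega) (by omega) (by omega) _ hc'').2 j (by omega)
    apply hfin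
    have e3 : ((c ∘ swap q (q + 1)) ∘ swap (q + 1) (q + 2)) (q + 1) = c (q + 2) := by
      rw [← e2]; simp
    rw [e3, hxm, ← hjm]
    simp [swap_apply_of_ne_of_ne (show j ≠ q by omega) (show j ≠ q + 1 by omega),
      swap_apply_of_ne_of_ne (show j ≠ q + 1 by omega) (show j ≠ q + 2 by omega)]

theorem exists_prod_eq_of_extendsAt {c : ℕ → ℂ} (h0 : c 0 = 0) (N : ℕ)
    (hc : ∀ k, 0 < k → k ≤ N → ExtendsAt c k) :
    ∃ a b : ℕ, a + b = N ∧ (∀ z : ℤ, (∃ j ≤ N, c j = z) ↔ -(a : ℤ) ≤ z ∧ z ≤ b) ∧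
      ∏ j ∈ Finset.range N, c (j + 1) = (-1) ^ a * a.factorial * b.factorial ∧
      (a = 0 → ∀ j ≤ N, c j = j) ∧ (b = 0 → ∀ j ≤ N, c j = -j) := by
  induction N with
  | zero =>
    refine ⟨0, 0, rfl, ?_, by simp, by simp [h0], by simp [h0]⟩
    intro z
    simp only [nonpos_iff_eq_zero, exists_eq_left, h0]
    norm_cast
    omega
  | succ N ih =>
    obtain ⟨a, b, hab, hI, hprod, ha, hb⟩ := ih fun k h1 h2 => hc k h1 (by omega)
    obtain ⟨⟨ε, hε, m, hm, j, hj, hjm⟩, hf⟩ := hc (N + 1) (by omega) le_rfl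
    rcases hε with rfl | rfl
    · have hmb : m = b := by
        have h1 := (hI m).1 ⟨j, by omega, by simp [hjm]⟩
        have h2 : ¬ (-(a : ℤ) ≤ (m + 1 : ℤ) ∧ (m + 1 : ℤ) ≤ b) := by
          intro h
          obtain ⟨i, hi, hi'⟩ := (hI (m + 1)).2 h
          exact hf i (by omega) (by rw [hi', hm]; push_cast; ring)
        omega
      subst hmb
      refine ⟨a, m + 1, by omega, ?_, ?_, ?_, by simp⟩
      · intro z
        have : (∃ j ≤ N + 1, c j = z) ↔ (∃ j ≤ N, c j = z) ∨ c (N + 1) = z := by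
          constructor
          · rintro ⟨i, hi, hi'⟩
            rcases Nat.le_succ_iff.1 hi with h | rfl
            · exact Or.inl ⟨i, h, hi'⟩
            · exact Or.inr hi'
          · rintro (⟨i, hi, hi'⟩ | h)
            · exact ⟨i, by omega, hi'⟩
            · exact ⟨N + 1, le_rfl, h⟩
        rw [this, hI, hm, one_mul]
        norm_cast
        omega
      · rw [Finset.prod_range_succ, hprod, hm, Nat.factorial_succ]; push_cast; ring
      · intro h i hi
        rcases Nat.le_succ_iff.1 hi with h' | rfl
        · exact ha h i h'
        · rw [hm, ← hab, h]; push_cast; ring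
    · have hmb : m = a := by
        have h1 := (hI (-m)).1 ⟨j, by omega, by simp [hjm]⟩
        have h2 : ¬ (-(a : ℤ) ≤ -(m + 1 : ℤ) ∧ -(m + 1 : ℤ) ≤ b) := by
          intro h
          obtain ⟨i, hi, hi'⟩ := (hI (-(m + 1))).2 h
          exact hf i (by omega) (by rw [hi', hm]; push_cast; ring)
        omega
      subst hmb
      refine ⟨m + 1, b, by omega, ?_, ?_, by simp, ?_⟩
      · intro z
        have : (∃ j ≤ N + 1, c j = z) ↔ (∃ j ≤ N, c j = z) ∨ c (N + 1) = z := by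
          constructor
          · rintro ⟨i, hi, hi'⟩
            rcases Nat.le_succ_iff.1 hi with h | rfl
            · exact Or.inl ⟨i, h, hi'⟩
            · exact Or.inr hi'
          · rintro (⟨i, hi, hi'⟩ | h)
            · exact ⟨i, by omega, hi'⟩
            · exact ⟨N + 1, le_rfl, h⟩
        rw [this, hI, hm, show (-1 * ((m : ℂ) + 1)) = ((-(m + 1) : ℤ) : ℂ) by push_cast; ring,
          Int.cast_inj]
        push_cast
        omega
      · rw [Finset.prod_range_succ, hprod, hm, Nat.factorial_succ]; push_cast; ring
      · intro h i hi
        rcases Nat.le_succ_iff.1 hi with h' | rfl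
        · exact hb h i h'
        · rw [hm, ← hab, h]; push_cast; ring

section JucysMurphy

variable {n : ℕ} {V : Type*} [AddCommGroup V] [Module ℂ V]
    (ρ : Representation ℂ (Perm (Fin n)) V)

theorem commute_jucysMurphy {σ : Perm (Fin n)} {j : Fin n} (hσ : σ j = j)
    (hσ' : ∀ i, i < j ↔ σ i < j) : Commute (ρ σ) (jucysMurphy ρ j) := by
  rw [Commute, SemiconjBy, jucysMurphy, Finset.mul_sum, Finset.sum_mul]
  refine Finset.sum_equiv σ (by simpa using hσ') fun i _ => ?_
  rw [← map_mul, ← map_mul]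
  congr 1
  have := mul_swap_eq_swap_mul σ i j
  rwa [hσ] at this

theorem jucysMurphy_commute_of_lt {j k : Fin n} (hjk : j < k) :
    Commute (jucysMurphy ρ j) (jucysMurphy ρ k) := by
  rw [jucysMurphy]
  refine Commute.sum_left _ _ _ fun i hi => ?_
  have hij : i < j := by simpa using hi
  refine commute_jucysMurphy ρ
    (swap_apply_of_ne_of_ne (hij.trans hjk).ne' hjk.ne') fun l => ?_
  rw [swap_apply_def]
  split_ifs with h1 h2
  · subst h1; simp [hjk, hij.trans hjk]
  · subst h2; simp [hjk, hij.trans hjk]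
  · rfl

theorem jucysMurphy_commute (j k : Fin n) :
    Commute (jucysMurphy ρ j) (jucysMurphy ρ k) := by
  rcases lt_trichotomy j k with h | rfl | h
  · exact jucysMurphy_commute_of_lt ρ h
  · exact Commute.refl _
  · exact (jucysMurphy_commute_of_lt ρ h).symm

theorem swap_mul_swap_mul_swap_eq {α : Type*} [DecidableEq α] {a b i : α} (ha : i ≠ a)
    (hb : i ≠ b) : swap a b * swap i a * swap a b = swap i b := by
  rw [mul_swap_eq_swap_mul (swap a b) i a, swap_apply_left, swap_apply_of_ne_of_ne ha hb,
    mul_assoc, swap_mul_self, mul_one]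

theorem jucysMurphy_succ {k : ℕ} (hk : k + 1 < n) :
    jucysMurphy ρ ⟨k + 1, hk⟩ =
      ρ (swap ⟨k, by omega⟩ ⟨k + 1, hk⟩) * jucysMurphy ρ ⟨k, by omega⟩ *
        ρ (swap ⟨k, by omega⟩ ⟨k + 1, hk⟩) + ρ (swap ⟨k, by omega⟩ ⟨k + 1, hk⟩) := by
  have h1 : (Finset.Iio (⟨k + 1, hk⟩ : Fin n)) =
      insert ⟨k, by omega⟩ (Finset.Iio ⟨k, by omega⟩) := by
    ext x; simp only [Finset.mem_Iio, Finset.mem_insert, Fin.ext_iff, Fin.lt_def]; omega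
  rw [jucysMurphy, h1, Finset.sum_insert (by simp), add_comm, jucysMurphy, Finset.mul_sum,
    Finset.sum_mul]
  congr 1
  refine Finset.sum_congr rfl fun i hi => ?_
  have hik : i.val < k := by simpa [Fin.lt_def] using hi
  rw [← map_mul, ← map_mul]
  congr 1
  refine (swap_mul_swap_mul_swap_eq ?_ ?_).symm <;> simp only [ne_eq, Fin.ext_iff] <;> omega

/-- The weights of the joint eigenvectors of the Jucys–Murphy elements. -/
def jmSpectrum : Set (ℕ → ℂ) :=
  {c | ∃ v : V, v ≠ 0 ∧ ∀ k : Fin n, jucysMurphy ρ k v = c k • v}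

theorem jmSpectrum_nonempty [FiniteDimensional ℂ V] [Nontrivial V] :
    (jmSpectrum ρ).Nonempty := by
  suffices h : ∀ m ≤ n, ∃ c : ℕ → ℂ, ∃ v : V, v ≠ 0 ∧
      ∀ k : Fin n, (k : ℕ) < m → jucysMurphy ρ k v = c k • v by
    obtain ⟨c, v, hv, hc⟩ := h n le_rfl
    exact ⟨c, v, hv, fun k => hc k k.2⟩
  intro m
  induction m with
  | zero =>
    intro _
    obtain ⟨v, hv⟩ := exists_ne (0 : V)
    exact ⟨0, v, hv, fun k hk => absurd hk (Nat.not_lt_zero _)⟩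
  | succ m ih =>
    intro hm
    obtain ⟨c, v, hv, hc⟩ := ih (by omega)
    let E : Submodule ℂ V := ⨅ k : Fin n, ⨅ _ : (k : ℕ) < m,
      LinearMap.ker (jucysMurphy ρ k - algebraMap ℂ _ (c k))
    have hE : ∀ x, x ∈ E ↔ ∀ k : Fin n, (k : ℕ) < m → jucysMurphy ρ k x = c k • x := by
      intro x
      simp [E, Submodule.mem_iInf, sub_eq_zero, Module.algebraMap_end_apply]
    have hmap : ∀ x ∈ E, jucysMurphy ρ ⟨m, hm⟩ x ∈ E := by
      intro x hx
      rw [hE] at hx ⊢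
      intro k hk
      have := congrArg (fun f => f x) (jucysMurphy_commute ρ k ⟨m, hm⟩).eq
      simp only [Module.End.mul_apply] at this
      rw [this, hx k hk, map_smul]
    have hvE : v ∈ E := (hE v).2 hc
    have : Nontrivial E := ⟨⟨v, hvE⟩, 0, by simpa [Subtype.ext_iff] using hv⟩
    obtain ⟨μ, hμ⟩ := Module.End.exists_eigenvalue ((jucysMurphy ρ ⟨m, hm⟩).restrict hmap)
    obtain ⟨w, hw⟩ := hμ.exists_hasEigenvector
    refine ⟨Function.update c m μ, w, by simpa using hw.2, fun k hk => ?_⟩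
    rcases Nat.lt_succ_iff_lt_or_eq.1 hk with h | h
    · rw [Function.update_of_ne h.ne]
      exact (hE w).1 w.2 k h
    · have := congrArg Subtype.val hw.apply_eq_smul
      obtain rfl : k = ⟨m, hm⟩ := Fin.ext h
      simpa using this

theorem jmSpectrum_zero {c : ℕ → ℂ} (hn : 0 < n) (hc : c ∈ jmSpectrum ρ) : c 0 = 0 := by
  obtain ⟨v, hv, h⟩ := hc
  have := h ⟨0, hn⟩
  have h1 : (Finset.Iio (⟨0, hn⟩ : Fin n)) = ∅ := by
    ext x; simp [Fin.lt_def]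
  rw [jucysMurphy, h1] at this
  simpa [hv] using this.symm

/-- The invariant Hermitian form obtained by averaging the pull-back of the standard form
along a linear functional. -/
noncomputable def averagedForm {G : Type*} [Group G] [Fintype G] (ρ : Representation ℂ G V)
    (ℓ : V →ₗ[ℂ] ℂ) : V →ₗ⋆[ℂ] V →ₗ[ℂ] ℂ :=
  LinearMap.mk₂'ₛₗ (starRingEnd ℂ) (RingHom.id ℂ)
    (fun x y => ∑ g : G, starRingEnd ℂ (ℓ (ρ g x)) * ℓ (ρ g y))
    (by intros; simp [add_mul, Finset.sum_add_distrib])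
    (by intros; simp [Finset.mul_sum, mul_assoc])
    (by intros; simp [mul_add, Finset.sum_add_distrib])
    (by intros; simp [Finset.mul_sum, mul_left_comm])

section averagedForm

variable {G : Type*} [Group G] [Fintype G] (π : Representation ℂ G V) (ℓ : V →ₗ[ℂ] ℂ)

theorem averagedForm_apply (x y : V) :
    averagedForm π ℓ x y = ∑ g : G, starRingEnd ℂ (ℓ (π g x)) * ℓ (π g y) := rfl

theorem averagedForm_map (g : G) (x y : V) :
    averagedForm π ℓ (π g x) (π g y) = averagedForm π ℓ x y := by
  simp only [averagedForm_apply, ← Module.End.mul_apply, ← map_mul]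
  exact Equiv.sum_comp (Equiv.mulRight g) fun h => starRingEnd ℂ (ℓ (π h x)) * ℓ (π h y)

theorem averagedForm_self_ne_zero {x : V} (hx : ℓ x ≠ 0) : averagedForm π ℓ x x ≠ 0 := by
  have h : averagedForm π ℓ x x = ((∑ g : G, Complex.normSq (ℓ (π g x)) : ℝ) : ℂ) := by
    rw [averagedForm_apply, Complex.ofReal_sum]
    exact Finset.sum_congr rfl fun g _ => (Complex.normSq_eq_conj_mul_self).symm
  rw [h, Complex.ofReal_ne_zero]
  refine (Finset.sum_pos' (fun g _ => Complex.normSq_nonneg _) ⟨1, Finset.mem_univ _, ?_⟩).ne'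
  simpa using Complex.normSq_pos.2 hx

end averagedForm

theorem averagedForm_jucysMurphy (ℓ : V →ₗ[ℂ] ℂ) (k : Fin n) (x y : V) :
    averagedForm ρ ℓ (jucysMurphy ρ k x) y = averagedForm ρ ℓ x (jucysMurphy ρ k y) := by
  simp only [jucysMurphy, LinearMap.sum_apply, map_sum]
  refine Finset.sum_congr rfl fun i _ => ?_
  rw [← averagedForm_map ρ ℓ (swap i k) x, ← Module.End.mul_apply, ← map_mul, swap_mul_self,
    map_one, Module.End.one_apply]

theorem exists_functional_ne_zero {v : V} (hv : v ≠ 0) : ∃ ℓ : V →ₗ[ℂ] ℂ, ℓ v ≠ 0 := by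
  by_contra! h
  exact hv ((Module.forall_dual_apply_eq_zero_iff ℂ v).1 h)

theorem conj_eq_of_jucysMurphy_eigen {v : V} (hv : v ≠ 0) {k : Fin n} {a : ℂ}
    (h : jucysMurphy ρ k v = a • v) : starRingEnd ℂ a = a := by
  obtain ⟨ℓ, hℓ⟩ := exists_functional_ne_zero hv
  have := averagedForm_jucysMurphy ρ ℓ k v v
  rw [h, LinearMap.map_smulₛₗ, LinearMap.smul_apply, map_smul] at this
  exact mul_right_cancel₀ (averagedForm_self_ne_zero ρ ℓ hℓ) this

section swap

variable {ρ} {c : ℕ → ℂ} {v : V} (hv : v ≠ 0)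
  (h : ∀ k : Fin n, jucysMurphy ρ k v = c k • v) {k : ℕ} (hk : k + 1 < n)

include h

/-- The intertwined vector has the swapped weight. -/
theorem jucysMurphy_intertwiner (j : Fin n) :
    jucysMurphy ρ j ((c (k + 1) - c k) • ρ (swap ⟨k, by omega⟩ ⟨k + 1, hk⟩) v - v) =
      c (swap k (k + 1) j) •
        ((c (k + 1) - c k) • ρ (swap ⟨k, by omega⟩ ⟨k + 1, hk⟩) v - v) := by
  set s : Perm (Fin n) := swap ⟨k, by omega⟩ ⟨k + 1, hk⟩ with hs
  have hss : ∀ x, ρ s (ρ s x) = x := fun x => by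
    rw [← Module.End.mul_apply, ← map_mul, hs, swap_mul_self, map_one, Module.End.one_apply]
  have hrel : ∀ x, jucysMurphy ρ ⟨k + 1, hk⟩ x =
      ρ s (jucysMurphy ρ ⟨k, by omega⟩ (ρ s x)) + ρ s x := fun x => by
    rw [jucysMurphy_succ ρ hk]; rfl
  have ha := h ⟨k, by omega⟩
  have hb := h ⟨k + 1, hk⟩
  simp only at ha hb
  have hb' : jucysMurphy ρ ⟨k + 1, hk⟩ (ρ s v) = c k • ρ s v + v := by
    rw [hrel, hss, ha, map_smul]
  have ha' : jucysMurphy ρ ⟨k, by omega⟩ (ρ s v) = c (k + 1) • ρ s v - v := by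
    have h1 := congrArg (ρ s) (hrel v)
    rw [hb, map_smul, map_add, hss, hss] at h1
    rw [h1]; abel
  by_cases hjk : j = ⟨k, by omega⟩
  · subst hjk
    rw [map_sub, map_smul, ha', ha, swap_apply_left]
    module
  by_cases hjk' : j = ⟨k + 1, hk⟩
  · subst hjk'
    rw [map_sub, map_smul, hb', hb, swap_apply_right]
    module
  · have h1 : (j : ℕ) ≠ k := fun h => hjk (Fin.ext h)
    have h2 : (j : ℕ) ≠ k + 1 := fun h => hjk' (Fin.ext h)
    have hcomm : Commute (ρ s) (jucysMurphy ρ j) := by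
      refine commute_jucysMurphy ρ (swap_apply_of_ne_of_ne hjk hjk') fun i => ?_
      rw [hs, swap_apply_def]
      split_ifs with h3 h4
      · subst h3; simp only [Fin.lt_def]; omega
      · subst h4; simp only [Fin.lt_def]; omega
      · rfl
    have h3 := congrArg (fun f => f v) hcomm.eq
    simp only [Module.End.mul_apply] at h3
    rw [map_sub, map_smul, ← h3, h j, swap_apply_of_ne_of_ne h1 h2, map_smul]
    module

include hv hk

theorem jucysMurphy_weight_succ_ne : c (k + 1) ≠ c k := by
  intro heq
  set s : Perm (Fin n) := swap ⟨k, by omega⟩ ⟨k + 1, hk⟩ with hs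
  obtain ⟨ℓ, hℓ⟩ := exists_functional_ne_zero hv
  have hrel := congrArg (ρ s) (congrArg (fun f => f v) (jucysMurphy_succ ρ hk))
  have hss : ∀ x, ρ s (ρ s x) = x := fun x => by
    rw [← Module.End.mul_apply, ← map_mul, hs, swap_mul_self, map_one, Module.End.one_apply]
  simp only [LinearMap.add_apply, Module.End.mul_apply, ← hs, map_add, hss] at hrel
  rw [h ⟨k + 1, hk⟩, map_smul] at hrel
  have h1 := averagedForm_jucysMurphy ρ ℓ ⟨k, by omega⟩ v (ρ s v)
  rw [h ⟨k, by omega⟩, LinearMap.map_smulₛₗ,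
    conj_eq_of_jucysMurphy_eigen ρ hv (h ⟨k, by omega⟩), LinearMap.smul_apply,
    eq_sub_of_add_eq hrel.symm, map_sub, map_smul] at h1
  simp only [heq] at h1
  exact averagedForm_self_ne_zero ρ ℓ hℓ (by linear_combination h1)

theorem swap_apply_eq_of_weight_adjacent
    (hadj : c (k + 1) = c k + 1 ∨ c (k + 1) = c k - 1) :
    ρ (swap ⟨k, by omega⟩ ⟨k + 1, hk⟩) v = (c (k + 1) - c k) • v := by
  have hint := jucysMurphy_intertwiner h hk ⟨k, by omega⟩
  have hne := jucysMurphy_weight_succ_ne hv h hk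
  set s : Perm (Fin n) := swap ⟨k, by omega⟩ ⟨k + 1, hk⟩ with hs
  have hss : ∀ x, ρ s (ρ s x) = x := fun x => by
    rw [← Module.End.mul_apply, ← map_mul, hs, swap_mul_self, map_one, Module.End.one_apply]
  set d := c (k + 1) - c k with hd
  have hd2 : d * d = 1 := by
    rcases hadj with h' | h' <;> rw [hd, h'] <;> ring
  set w := d • ρ s v - v with hw
  have hw0 : w = 0 := by
    by_contra hw0
    obtain ⟨ℓ, hℓ⟩ := exists_functional_ne_zero hw0
    have h1 := averagedForm_jucysMurphy ρ ℓ ⟨k, by omega⟩ v w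
    rw [hint, h ⟨k, by omega⟩, LinearMap.map_smulₛₗ,
      conj_eq_of_jucysMurphy_eigen ρ hv (h ⟨k, by omega⟩), LinearMap.smul_apply,
      map_smul, smul_eq_mul, smul_eq_mul, swap_apply_left] at h1
    have h2 : averagedForm ρ ℓ v w = 0 := by
      have : (c (k + 1) - c k) * averagedForm ρ ℓ v w = 0 := by linear_combination -h1
      exact (mul_eq_zero.1 this).resolve_left (sub_ne_zero.2 hne)
    have h3 : averagedForm ρ ℓ (ρ s v) w = 0 := by
      have h4 : ρ s w = -(d • w) := by
        rw [hw, map_sub, map_smul, hss, smul_sub, smul_smul, hd2, one_smul]; abel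
      rw [← averagedForm_map ρ ℓ s, hss, h4, map_neg, map_smul, h2]
      simp
    refine averagedForm_self_ne_zero ρ ℓ hℓ ?_
    have h6 : averagedForm ρ ℓ w = starRingEnd ℂ d • averagedForm ρ ℓ (ρ s v) -
        averagedForm ρ ℓ v := by
      rw [hw, map_sub, LinearMap.map_smulₛₗ]
    rw [h6, LinearMap.sub_apply, LinearMap.smul_apply, h2, h3, smul_zero, sub_zero]
  have h5 : d • ρ s v = v := sub_eq_zero.1 (hw ▸ hw0)
  calc ρ s v = (d * d) • ρ s v := by rw [hd2, one_smul]
    _ = d • v := by rw [mul_smul, h5]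

end swap

variable {ρ}

theorem jmSpectrum_comp_swap {c : ℕ → ℂ} (hc : c ∈ jmSpectrum ρ) {k : ℕ} (hk : k + 1 < n)
    (h1 : c (k + 1) ≠ c k + 1) (h2 : c (k + 1) ≠ c k - 1) :
    c ∘ swap k (k + 1) ∈ jmSpectrum ρ := by
  obtain ⟨v, hv, h⟩ := hc
  refine ⟨_, ?_, jucysMurphy_intertwiner h hk⟩
  intro h0
  set s : Perm (Fin n) := swap ⟨k, by omega⟩ ⟨k + 1, hk⟩ with hs
  have hss : ρ s (ρ s v) = v := by
    rw [← Module.End.mul_apply, ← map_mul, hs, swap_mul_self, map_one, Module.End.one_apply]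
  set d := c (k + 1) - c k with hd
  have h3 : d • ρ s v = v := sub_eq_zero.1 h0
  have h4 : (d * d - 1) • v = 0 := by
    have h5 := congrArg (fun x => d • ρ s x) h3
    simp only [map_smul, hss] at h5
    rw [sub_smul, mul_smul, h5, h3, one_smul, sub_self]
  have h5 := (smul_eq_zero.1 h4).resolve_right hv
  have h6 : (d - 1) * (d + 1) = 0 := by linear_combination h5
  rcases mul_eq_zero.1 h6 with h7 | h7
  · exact h1 (by linear_combination h7)
  · exact h2 (by linear_combination h7)

theorem jmSpectrum_not_braid {c : ℕ → ℂ} (hc : c ∈ jmSpectrum ρ) {k : ℕ} (hk : k + 2 < n)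
    (hadj : c (k + 1) = c k + 1 ∨ c (k + 1) = c k - 1) : c (k + 2) ≠ c k := by
  obtain ⟨v, hv, h⟩ := hc
  intro heq
  have h1 := swap_apply_eq_of_weight_adjacent hv h (k := k) (by omega) hadj
  have h2 := swap_apply_eq_of_weight_adjacent hv h (k := k + 1) (by omega) (by
    rw [heq]
    rcases hadj with h' | h' <;> rw [h']
    · right; ring
    · left; ring)
  rw [heq] at h2
  set d := c (k + 1) - c k with hd
  have hd2 : d * d = 1 := by
    rcases hadj with h' | h' <;> rw [hd, h'] <;> ring
  rw [show c k - c (k + 1) = -d by rw [hd]; ring] at h2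
  set s : Perm (Fin n) := swap ⟨k, by omega⟩ ⟨k + 1, by omega⟩ with hs
  set t : Perm (Fin n) := swap ⟨k + 1, by omega⟩ ⟨k + 2, by omega⟩ with ht
  have hbraid : s * t * s = t * s * t := by
    have e1 : s * t * s = swap ⟨k, by omega⟩ ⟨k + 2, by omega⟩ := by
      rw [hs, ht, swap_comm (⟨k, by omega⟩ : Fin n), swap_comm (⟨k + 1, by omega⟩ : Fin n)
        ⟨k + 2, hk⟩, swap_mul_swap_mul_swap_eq (by simp) (by simp), swap_comm]
    have e2 : t * s * t = swap ⟨k, by omega⟩ ⟨k + 2, by omega⟩ := by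
      rw [hs, ht, swap_mul_swap_mul_swap_eq (by simp) (by simp)]
    rw [e1, e2]
  have h3 := congrArg (fun g => ρ g v) hbraid
  simp only [map_mul, Module.End.mul_apply, h1, h2, map_smul, smul_smul] at h3
  have h4 := smul_left_injective ℂ hv h3
  have hd0 : d = 0 := by grind
  simp [hd0] at hd2

end JucysMurphy

section FDRep

open CategoryTheory

theorem FDRep.eq_bot_or_eq_top_of_simple {G : Type*} [Group G] (V : FDRep ℂ G) [Simple V]
    (W : Submodule ℂ V) (hW : ∀ g, ∀ v ∈ W, V.ρ g v ∈ W) : W = ⊥ ∨ W = ⊤ := by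
  let S : Subrepresentation V.ρ := ⟨W, hW⟩
  let f : FDRep.of S.toRepresentation ⟶ V :=
    ⟨InducedCategory.homMk (ModuleCat.ofHom W.subtype), fun g => by ext; rfl⟩
  have hf : ∀ w : W, f w = (w : V) := fun w => rfl
  have : Mono f := ConcreteCategory.mono_of_injective f Subtype.val_injective
  by_cases h0 : f = 0
  · left
    rw [Submodule.eq_bot_iff]
    intro w hw
    have h1 := hf ⟨w, hw⟩
    rw [h0] at h1
    exact h1.symm
  · right
    have := isIso_of_mono_of_nonzero h0
    rw [Submodule.eq_top_iff']
    intro x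
    obtain ⟨w, rfl⟩ := (FDRep.isoToLinearEquiv (asIso f)).surjective x
    exact w.2

theorem FDRep.nontrivial_of_simple {G : Type*} [Group G] (V : FDRep ℂ G) [Simple V] :
    Nontrivial V := by
  rw [← not_subsingleton_iff_nontrivial]
  intro h
  exact id_nonzero V (by ext x; exact Subsingleton.elim _ _)

theorem FDRep.simple_of_isIrreducible {G : Type} [Group G] [Finite G] {V : Type} [AddCommGroup V]
    [Module ℂ V] [FiniteDimensional ℂ V] (ρ : Representation ℂ G V) [ρ.IsIrreducible] :
    Simple (FDRep.of ρ) := by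
  classical
  have := Fintype.ofFinite G
  have := invertibleOfNonzero (NeZero.ne (Nat.card G : ℂ))
  have h := Representation.char_orthonormal ρ ρ
  rw [if_pos ⟨.refl ρ⟩, inv_mul_eq_one₀ (NeZero.ne _)] at h
  rw [FDRep.simple_iff_char_is_norm_one]
  exact h.symm

theorem Representation.exists_isIrreducible_toRepresentation {G V : Type*} [Group G]
    [AddCommGroup V] [Module ℂ V] [FiniteDimensional ℂ V] (ρ : Representation ℂ G V)
    {E : Submodule ℂ V} (hE : ∀ g, ∀ v ∈ E, ρ g v ∈ E) (hE0 : E ≠ ⊥) :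
    ∃ S : Subrepresentation ρ, S.toSubmodule ≤ E ∧ S.toRepresentation.IsIrreducible := by
  let p : ℕ → Prop := fun d => ∃ S : Subrepresentation ρ, S.toSubmodule ≤ E ∧
    S.toSubmodule ≠ ⊥ ∧ Module.finrank ℂ S.toSubmodule = d
  have hp : ∃ d, p d := ⟨_, ⟨E, hE⟩, le_rfl, hE0, rfl⟩
  classical
  obtain ⟨S, hSE, hS0, hSd⟩ := Nat.find_spec hp
  refine ⟨S, hSE, ?_⟩
  have hbot : ∀ T : Subrepresentation S.toRepresentation, T.toSubmodule = ⊥ → T = ⊥ :=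
    fun T hT => Subrepresentation.toSubmodule_injective hT
  have htop : ∀ T : Subrepresentation S.toRepresentation, T.toSubmodule = ⊤ → T = ⊤ :=
    fun T hT => Subrepresentation.toSubmodule_injective hT
  refine { exists_pair_ne := ⟨⊥, ⊤, fun h => ?_⟩, eq_bot_or_eq_top := fun T => ?_ }
  · have h1 : (⊥ : Submodule ℂ S.toSubmodule) = ⊤ :=
      congrArg Subrepresentation.toSubmodule h
    have := (Submodule.nontrivial_iff_ne_bot).2 hS0
    exact bot_ne_top h1
  · by_cases hT : T.toSubmodule = ⊥
    · exact Or.inl (hbot T hT)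
    · refine Or.inr (htop T (Submodule.eq_top_of_finrank_eq (le_antisymm
        (Submodule.finrank_le _) ?_)))
      rw [hSd]
      refine Nat.find_le ?_
      refine ⟨⟨T.toSubmodule.map S.toSubmodule.subtype, ?_⟩, ?_, ?_, ?_⟩
      · rintro g _ ⟨t, ht, rfl⟩
        exact ⟨_, T.apply_mem_toSubmodule g ht, rfl⟩
      · exact (Submodule.map_subtype_le _ _).trans hSE
      · rwa [(Submodule.map_injective_of_injective
          S.toSubmodule.injective_subtype).ne_iff' (Submodule.map_bot _)]
      · exact Submodule.finrank_map_subtype_eq _ _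

end FDRep

section sumCycles

variable {n : ℕ} {V : Type*} [AddCommGroup V] [Module ℂ V]
    (ρ : Representation ℂ (Perm (Fin n)) V)

theorem commute_sumCycles (g : Perm (Fin n)) : Commute (ρ g) (sumCycles ρ) := by
  rw [Commute, SemiconjBy, sumCycles, Finset.mul_sum, Finset.sum_mul]
  refine Finset.sum_equiv (MulAut.conj g).toEquiv (fun x => ?_) fun x _ => ?_
  · simp only [mem_cyclesOn, MulEquiv.toEquiv_eq_coe, EquivLike.coe_coe, MulAut.conj_apply,
      Perm.support_conj]
    rw [← Finset.map_univ_equiv g, Finset.map_inj, Finset.map_univ_equiv]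
    refine and_congr_left fun _ => ⟨Perm.IsCycle.conj, fun h => ?_⟩
    have h1 : (g⁻¹ * (g * x * g⁻¹) * g⁻¹⁻¹).IsCycle := h.conj
    simpa [mul_assoc] using h1
  · rw [← map_mul, ← map_mul]
    simp

theorem card_cyclesOn_univ (hn : 2 ≤ n) :
    (cyclesOn (Finset.univ : Finset (Fin n))).card = (n - 1).factorial := by
  have h := Perm.card_of_cycleType_singleton (α := Fin n) hn (by simp)
  rw [Fintype.card_fin, Nat.choose_self, mul_one] at h
  rw [← h]
  congr 1
  ext g
  simp only [mem_cyclesOn, Finset.mem_filter, Finset.mem_univ, true_and]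
  constructor
  · rintro ⟨hg, hs⟩
    rw [hg.cycleType, hs]; simp
  · intro hg
    have h1 : g.IsCycle := Perm.card_cycleType_eq_one.1 (by rw [hg]; simp)
    refine ⟨h1, Finset.card_eq_iff_eq_univ _ |>.1 ?_⟩
    rw [h1.cycleType] at hg
    simpa using hg

theorem trace_sumCycles (hn : 2 ≤ n) {h : Perm (Fin n)} (hh : h ∈ cyclesOn Finset.univ) :
    LinearMap.trace ℂ V (sumCycles ρ) = (n - 1).factorial * ρ.character h := by
  rw [sumCycles, map_sum, ← card_cyclesOn_univ hn, ← nsmul_eq_mul]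
  refine Finset.sum_eq_card_nsmul fun g hg => ?_
  rw [mem_cyclesOn] at hh hg
  obtain ⟨x, rfl⟩ := isConj_iff.1 (hh.1.isConj hg.1 (by rw [hh.2, hg.2]))
  exact ρ.char_conj h x

theorem character_div_eq_of_sumCycles [FiniteDimensional ℂ V] [Nontrivial V] (hn : 2 ≤ n)
    {h : Perm (Fin n)} (hh : h ∈ cyclesOn Finset.univ) {a : ℂ}
    (ha : ∀ v, sumCycles ρ v = a • v) :
    ρ.character h / ρ.character 1 = a / (n - 1).factorial := by
  have h1 := trace_sumCycles ρ hn hh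
  have h2 : sumCycles ρ = a • 1 := LinearMap.ext ha
  rw [h2, map_smul, LinearMap.trace_one, smul_eq_mul] at h1
  have h3 : (Module.finrank ℂ V : ℂ) ≠ 0 := Nat.cast_ne_zero.2 Module.finrank_pos.ne'
  have h4 : ((n - 1).factorial : ℂ) ≠ 0 := Nat.cast_ne_zero.2 (Nat.factorial_ne_zero _)
  rw [ρ.char_one, div_eq_div_iff h3 h4]
  linear_combination -h1

theorem eigenspace_sumCycles_invariant (a : ℂ) (g : Perm (Fin n)) :
    ∀ v ∈ (sumCycles ρ).eigenspace a, ρ g v ∈ (sumCycles ρ).eigenspace a := by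
  intro v hv
  rw [Module.End.mem_eigenspace_iff] at hv ⊢
  rw [← Module.End.mul_apply, ← (commute_sumCycles ρ g).eq, Module.End.mul_apply, hv, map_smul]

theorem sumCycles_eq_smul_of_simple (V : FDRep ℂ (Perm (Fin n))) [CategoryTheory.Simple V]
    {v : V} (hv : v ≠ 0) {a : ℂ} (ha : sumCycles V.ρ v = a • v) (w : V) :
    sumCycles V.ρ w = a • w := by
  rw [← Module.End.mem_eigenspace_iff]
  rcases FDRep.eq_bot_or_eq_top_of_simple V _ (eigenspace_sumCycles_invariant V.ρ a) with h | h
  · rw [← Module.End.mem_eigenspace_iff, h] at ha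
    exact absurd ha hv
  · rw [h]; trivial

theorem exists_simple_of_sumCycles {V : Type} [AddCommGroup V] [Module ℂ V]
    [FiniteDimensional ℂ V] (ρ : Representation ℂ (Perm (Fin n)) V) (hn : 2 ≤ n) {a : ℂ} {v : V}
    (hv : v ≠ 0) (ha : sumCycles ρ v = a • v) {h : Perm (Fin n)}
    (hh : h ∈ cyclesOn Finset.univ) :
    ∃ W : FDRep ℂ (Perm (Fin n)), CategoryTheory.Simple W ∧
      W.character h / W.character 1 = a / (n - 1).factorial := by
  have hE0 : (sumCycles ρ).eigenspace a ≠ ⊥ := by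
    rw [Submodule.ne_bot_iff]
    exact ⟨v, Module.End.mem_eigenspace_iff.2 ha, hv⟩
  obtain ⟨S, hSE, hS⟩ := ρ.exists_isIrreducible_toRepresentation
    (eigenspace_sumCycles_invariant ρ a) hE0
  refine ⟨FDRep.of S.toRepresentation, FDRep.simple_of_isIrreducible _, ?_⟩
  have : Nontrivial S.toSubmodule := by
    rw [Submodule.nontrivial_iff_ne_bot]
    intro h0
    exact bot_ne_top (α := Subrepresentation S.toRepresentation)
      (Subrepresentation.toSubmodule_injective (by
        show (⊥ : Submodule ℂ S.toSubmodule) = ⊤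
        rw [h0]; exact Subsingleton.elim _ _))
  refine character_div_eq_of_sumCycles S.toRepresentation hn hh fun w => Subtype.ext ?_
  have hw := Module.End.mem_eigenspace_iff.1 (hSE w.2)
  rw [sumCycles, LinearMap.sum_apply] at hw ⊢
  rw [AddSubmonoidClass.coe_finsetSum]
  exact hw

end sumCycles

section upperBound

variable {n : ℕ}

theorem finrank_eq_one_of_swap (V : FDRep ℂ (Perm (Fin n))) [CategoryTheory.Simple V] {v : V}
    (hv : v ≠ 0) (h : ∀ k (hk : k + 1 < n), ∃ a : ℂ,
      V.ρ (swap ⟨k, by omega⟩ ⟨k + 1, hk⟩) v = a • v) :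
    Module.finrank ℂ V = 1 := by
  have hall : ∀ g, ∃ a : ℂ, V.ρ g v = a • v := by
    let M : Submonoid (Perm (Fin n)) :=
      { carrier := {g | ∃ a : ℂ, V.ρ g v = a • v}
        one_mem' := ⟨1, by simp⟩
        mul_mem' := by
          rintro x y ⟨a, ha⟩ ⟨b, hb⟩
          exact ⟨b * a, by rw [map_mul, Module.End.mul_apply, hb, map_smul, ha, smul_smul]⟩ }
    suffices hM : M = ⊤ from fun g => (hM ▸ Submonoid.mem_top g : g ∈ M)
    cases n with
    | zero => exact Subsingleton.elim _ _
    | succ m =>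
      rw [eq_top_iff, ← Perm.mclosure_swap_castSucc_succ, Submonoid.closure_le]
      rintro _ ⟨i, rfl⟩
      exact h i (by omega)
  rcases FDRep.eq_bot_or_eq_top_of_simple V (Submodule.span ℂ {v}) (fun g w hw => by
    obtain ⟨b, rfl⟩ := Submodule.mem_span_singleton.1 hw
    obtain ⟨a, ha⟩ := hall g
    rw [map_smul, ha]
    exact Submodule.smul_mem _ _ (Submodule.smul_mem _ _
      (Submodule.mem_span_singleton_self v))) with h0 | h0
  · exact absurd (Submodule.span_singleton_eq_bot.1 h0) hv
  · rw [← finrank_top, ← h0, finrank_span_singleton hv]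

theorem exists_sumCycles_eq_smul (V : FDRep ℂ (Perm (Fin n))) [CategoryTheory.Simple V]
    (hn : 2 ≤ n) (hV : Module.finrank ℂ V ≠ 1) :
    ∃ a : ℂ, (∀ w, sumCycles V.ρ w = a • w) ∧ (a = 0 ∨ ∃ p q : ℕ, 0 < p ∧ 0 < q ∧
      p + q = n - 1 ∧ a = (-1) ^ p * p.factorial * q.factorial) := by
  have := FDRep.nontrivial_of_simple V
  obtain ⟨c, hc⟩ := jmSpectrum_nonempty V.ρ
  obtain ⟨v, hv, hcv⟩ := id hc
  have hscalar := sumCycles_eq_smul_of_simple V hv (sumCycles_apply V.ρ hn hcv)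
  refine ⟨_, hscalar, ?_⟩
  set a := ∏ j ∈ Finset.range (n - 1), c (j + 1) with ha
  by_cases ha0 : a = 0
  · exact Or.inl ha0
  have hprod : ∀ d ∈ jmSpectrum V.ρ, ∏ j ∈ Finset.range (n - 1), d (j + 1) = a := by
    rintro d ⟨w, hw, hdw⟩
    have h1 := hscalar w
    rw [sumCycles_apply V.ρ hn hdw] at h1
    exact smul_left_injective ℂ hw h1
  have hext : ∀ k, 0 < k → k < n → ∀ d ∈ jmSpectrum V.ρ, ExtendsAt d k :=
    extendsAt_of_swap_closed (fun d hd => jmSpectrum_zero V.ρ (by omega) hd)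
      (fun d hd k hk hkn hdk => ha0 (by
        rw [← hprod d hd]
        refine Finset.prod_eq_zero (i := k - 1) (Finset.mem_range.2 (by omega)) ?_
        rwa [Nat.sub_add_cancel hk]))
      (fun d hd k hk => by
        obtain ⟨w, hw, hdw⟩ := hd
        exact jucysMurphy_weight_succ_ne hw hdw hk)
      (fun d hd k hk h1 h2 => jmSpectrum_comp_swap hd hk h1 h2)
      (fun d hd k hk h1 => jmSpectrum_not_braid hd hk h1)
  obtain ⟨p, q, hpq, -, hval, hp, hq⟩ := exists_prod_eq_of_extendsAt
    (jmSpectrum_zero V.ρ (by omega) hc) (n - 1)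
    (fun k hk hkn => hext k hk (by omega) c hc)
  refine Or.inr ⟨p, q, Nat.pos_of_ne_zero fun h0 => hV ?_,
    Nat.pos_of_ne_zero fun h0 => hV ?_, hpq, hval⟩
  · have h1 := hp h0
    refine finrank_eq_one_of_swap V hv fun k hk =>
      ⟨_, swap_apply_eq_of_weight_adjacent hv hcv hk (Or.inl ?_)⟩
    rw [h1 _ (by omega), h1 _ (by omega)]
    push_cast; ring
  · have h1 := hq h0
    refine finrank_eq_one_of_swap V hv fun k hk =>
      ⟨_, swap_apply_eq_of_weight_adjacent hv hcv hk (Or.inr ?_)⟩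
    rw [h1 _ (by omega), h1 _ (by omega)]
    push_cast; ring

end upperBound

section weightVectors

variable {n : ℕ}

/-- The permutation representation on functions on a set with an action. -/
noncomputable def permRepresentation (X : Type) [MulAction (Perm (Fin n)) X] :
    Representation ℂ (Perm (Fin n)) (X → ℂ) where
  toFun g := LinearMap.funLeft ℂ ℂ (g⁻¹ • ·)
  map_one' := by ext; simp [LinearMap.funLeft_apply]
  map_mul' g h := by ext; simp [LinearMap.funLeft_apply, mul_smul]

theorem permRepresentation_single {X : Type} [DecidableEq X] [MulAction (Perm (Fin n)) X]
    (g : Perm (Fin n)) (x : X) :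
    permRepresentation X g (Pi.single x 1) = Pi.single (g • x) 1 := by
  ext y
  simp [permRepresentation, LinearMap.funLeft_apply, Pi.single_apply, inv_smul_eq_iff]

/-- The twist of a representation by the sign character. -/
noncomputable def signTwist {V : Type*} [AddCommGroup V] [Module ℂ V]
    (ρ : Representation ℂ (Perm (Fin n)) V) : Representation ℂ (Perm (Fin n)) V where
  toFun g := ((Perm.sign g : ℤ) : ℂ) • ρ g
  map_one' := by simp
  map_mul' g h := by simp [smul_smul, mul_comm]

theorem jucysMurphy_signTwist {V : Type*} [AddCommGroup V] [Module ℂ V]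
    (ρ : Representation ℂ (Perm (Fin n)) V) (k : Fin n) :
    jucysMurphy (signTwist ρ) k = -jucysMurphy ρ k := by
  rw [jucysMurphy, jucysMurphy, ← Finset.sum_neg_distrib]
  refine Finset.sum_congr rfl fun i hi => ?_
  have hik : i ≠ k := (Finset.mem_Iio.1 hi).ne
  simp [signTwist, Perm.sign_swap hik]

theorem jucysMurphy_apply_point {V : Type*} [AddCommGroup V] [Module ℂ V]
    {ρ : Representation ℂ (Perm (Fin n)) V} {e : Fin n → V} (he : ∀ g x, ρ g (e x) = e (g x))
    {x k : Fin n} (hx : x < k) :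
    jucysMurphy ρ k (e x) = ((k : ℂ) - 1) • e x + e k := by
  have h : ∀ i ∈ Finset.Iio k, ρ (swap i k) (e x) = e x + if i = x then e k - e x else 0 := by
    intro i _
    rw [he, swap_apply_def]
    split_ifs with h1 h2 h3 h4 <;> grind
  rw [jucysMurphy, LinearMap.sum_apply, Finset.sum_congr rfl h, Finset.sum_add_distrib,
    Finset.sum_ite_eq', if_pos (Finset.mem_Iio.2 hx), Finset.sum_const, Fin.card_Iio,
    ← Nat.cast_smul_eq_nsmul ℂ]
  module

theorem jucysMurphy_apply_pair {V : Type*} [AddCommGroup V] [Module ℂ V]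
    {ρ : Representation ℂ (Perm (Fin n)) V} {e : Fin n → Fin n → V}
    (he : ∀ g x y, ρ g (e x y) = e (g x) (g y)) {x y k : Fin n} (hx : x < k) (hy : y < k)
    (hxy : x ≠ y) :
    jucysMurphy ρ k (e x y) = ((k : ℂ) - 2) • e x y + e k y + e x k := by
  have h : ∀ i ∈ Finset.Iio k, ρ (swap i k) (e x y) = e x y +
      (if i = x then e k y - e x y else 0) + if i = y then e x k - e x y else 0 := by
    intro i _
    rw [he, swap_apply_def, swap_apply_def]
    split_ifs <;> grind
  rw [jucysMurphy, LinearMap.sum_apply, Finset.sum_congr rfl h, Finset.sum_add_distrib,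
    Finset.sum_add_distrib, Finset.sum_ite_eq', Finset.sum_ite_eq', if_pos (Finset.mem_Iio.2 hx),
    if_pos (Finset.mem_Iio.2 hy), Finset.sum_const, Fin.card_Iio, ← Nat.cast_smul_eq_nsmul ℂ]
  module

theorem exists_sumCycles_eq_neg_one_pow_smul (m : ℕ) :
    ∃ (V : Type) (_ : AddCommGroup V) (_ : Module ℂ V) (_ : FiniteDimensional ℂ V)
      (ρ : Representation ℂ (Perm (Fin (m + 2))) V) (v : V), v ≠ 0 ∧
      sumCycles ρ v = ((-1) ^ m * m.factorial : ℂ) • v := by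
  let e : Fin (m + 2) → Fin (m + 2) → ℂ := fun x => Pi.single x 1
  have he : ∀ g x, permRepresentation (Fin (m + 2)) g (e x) = e (g x) :=
    permRepresentation_single
  let ρ := signTwist (permRepresentation (n := m + 2) (Fin (m + 2)))
  let c : ℕ → ℂ := fun k => if k ≤ 1 then k else 1 - k
  obtain ⟨x, hx⟩ : ∃ x : Fin (m + 2), (x : ℕ) = 0 := ⟨0, rfl⟩
  obtain ⟨y, hy⟩ : ∃ y : Fin (m + 2), (y : ℕ) = 1 := ⟨1, rfl⟩
  have hxy : x ≠ y := by rw [Ne, Fin.ext_iff]; omega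
  have hc : ∀ k : Fin (m + 2), jucysMurphy ρ k (e x - e y) = c k • (e x - e y) := by
    intro k
    rw [jucysMurphy_signTwist, LinearMap.neg_apply]
    by_cases hk : (k : ℕ) ≤ 1
    · rcases Nat.le_one_iff_eq_zero_or_eq_one.1 hk with h | h
      · have h0 : Finset.Iio k = ∅ :=
          Finset.eq_empty_of_forall_notMem fun i hi => by
            rw [Finset.mem_Iio, Fin.lt_def] at hi; omega
        simp [jucysMurphy, h0, c, h]
      · obtain rfl : k = y := Fin.ext (h.trans hy.symm)
        have h1 : Finset.Iio k = {x} := by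
          ext i; simp only [Finset.mem_Iio, Finset.mem_singleton, Fin.lt_def, Fin.ext_iff]; omega
        rw [jucysMurphy, h1, Finset.sum_singleton, map_sub, he, he, swap_apply_left,
          swap_apply_right]
        simp [c, h]
    · have h0 : x < k := by rw [Fin.lt_def]; omega
      have h1 : y < k := by rw [Fin.lt_def]; omega
      rw [map_sub, jucysMurphy_apply_point he h0, jucysMurphy_apply_point he h1]
      simp only [c, if_neg hk]
      module
  have hprod : ∀ m, ∏ j ∈ Finset.range (m + 1), c (j + 1) = (-1) ^ m * m.factorial := by
    intro m
    induction m with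
    | zero => simp [c]
    | succ m ih =>
      rw [Finset.prod_range_succ, ih, Nat.factorial_succ]
      simp only [c, if_neg (show ¬ m + 1 + 1 ≤ 1 by omega)]
      push_cast
      ring
  refine ⟨_, inferInstance, inferInstance, inferInstance, ρ, e x - e y, fun h => ?_, ?_⟩
  · simpa [e, hxy] using congrFun h x
  · rw [sumCycles_apply ρ (by omega) hc, ← hprod]
    rfl

theorem exists_sumCycles_eq_two_mul_smul (m : ℕ) :
    ∃ (V : Type) (_ : AddCommGroup V) (_ : Module ℂ V) (_ : FiniteDimensional ℂ V)
      (ρ : Representation ℂ (Perm (Fin (m + 3))) V) (v : V), v ≠ 0 ∧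
      sumCycles ρ v = (2 * m.factorial : ℂ) • v := by
  let e : Fin (m + 3) → Fin (m + 3) → Fin (m + 3) × Fin (m + 3) → ℂ :=
    fun x y => Pi.single (x, y) 1
  let ρ := permRepresentation (n := m + 3) (Fin (m + 3) × Fin (m + 3))
  have he : ∀ g x y, ρ g (e x y) = e (g x) (g y) :=
    fun g x y => permRepresentation_single g (x, y)
  obtain ⟨x, hx⟩ : ∃ x : Fin (m + 3), (x : ℕ) = 0 := ⟨0, rfl⟩
  obtain ⟨y, hy⟩ : ∃ y : Fin (m + 3), (y : ℕ) = 1 := ⟨1, rfl⟩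
  obtain ⟨z, hz⟩ : ∃ z : Fin (m + 3), (z : ℕ) = 2 := ⟨⟨2, by omega⟩, rfl⟩
  have hxy : x ≠ y := by rw [Ne, Fin.ext_iff]; omega
  have hxz : x ≠ z := by rw [Ne, Fin.ext_iff]; omega
  have hyz : y ≠ z := by rw [Ne, Fin.ext_iff]; omega
  let v := e x y + e y z + e z x - e y x - e z y - e x z
  let c : ℕ → ℂ := fun k => if k ≤ 2 then -k else k - 2
  have hc : ∀ k : Fin (m + 3), jucysMurphy ρ k v = c k • v := by
    intro k
    by_cases hk : (k : ℕ) ≤ 2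
    · obtain h | h | h : (k : ℕ) = 0 ∨ (k : ℕ) = 1 ∨ (k : ℕ) = 2 := by omega
      · have h0 : Finset.Iio k = ∅ :=
          Finset.eq_empty_of_forall_notMem fun i hi => by
            rw [Finset.mem_Iio, Fin.lt_def] at hi; omega
        simp [jucysMurphy, h0, c, h]
      · obtain rfl : k = y := Fin.ext (h.trans hy.symm)
        have h1 : Finset.Iio k = {x} := by
          ext i; simp only [Finset.mem_Iio, Finset.mem_singleton, Fin.lt_def, Fin.ext_iff]; omega
        rw [jucysMurphy, h1, Finset.sum_singleton]
        simp only [v, map_sub, map_add, he, swap_apply_left, swap_apply_right,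
          swap_apply_of_ne_of_ne hxz.symm hyz.symm, c, h]
        simp
        abel
      · obtain rfl : k = z := Fin.ext (h.trans hz.symm)
        have h1 : Finset.Iio k = {x, y} := by
          ext i
          simp only [Finset.mem_Iio, Finset.mem_singleton, Finset.mem_insert, Fin.lt_def,
            Fin.ext_iff]
          omega
        rw [jucysMurphy, h1, Finset.sum_pair hxy, LinearMap.add_apply]
        simp only [v, map_sub, map_add, he, swap_apply_left, swap_apply_right,
          swap_apply_of_ne_of_ne hxy.symm hyz, swap_apply_of_ne_of_ne hxy hxz, c, h]
        simp only [le_refl, if_true, Nat.cast_ofNat]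
        module
    · have h0 : x < k := by rw [Fin.lt_def]; omega
      have h1 : y < k := by rw [Fin.lt_def]; omega
      have h2 : z < k := by rw [Fin.lt_def]; omega
      simp only [v, map_sub, map_add, jucysMurphy_apply_pair he h0 h1 hxy,
        jucysMurphy_apply_pair he h1 h0 hxy.symm, jucysMurphy_apply_pair he h0 h2 hxz,
        jucysMurphy_apply_pair he h2 h0 hxz.symm, jucysMurphy_apply_pair he h1 h2 hyz,
        jucysMurphy_apply_pair he h2 h1 hyz.symm, c, if_neg hk]
      module
  have hprod : ∀ m, ∏ j ∈ Finset.range (m + 2), c (j + 1) = 2 * m.factorial := by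
    intro m
    induction m with
    | zero => norm_num [c, Finset.prod_range_succ]
    | succ m ih =>
      rw [Finset.prod_range_succ, ih, Nat.factorial_succ]
      simp only [c, if_neg (show ¬ m + 2 + 1 ≤ 2 by omega)]
      push_cast
      ring
  refine ⟨_, inferInstance, inferInstance, inferInstance, ρ, v, fun h => ?_, ?_⟩
  · simpa [v, e, Pi.single_apply, hxy, hxz, hyz, hxy.symm, hxz.symm, hyz.symm] using
      congrFun h (x, y)
  · rw [sumCycles_apply ρ (by omega) hc, ← hprod]
    rfl

end weightVectors

section ratio

theorem factorial_mul_factorial_le (r a b : ℕ) :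
    (a + r).factorial * (b + r).factorial ≤ r.factorial * (a + b + r).factorial := by
  induction a with
  | zero => simp
  | succ a ih =>
    rw [show a + 1 + r = a + r + 1 by ring, show a + 1 + b + r = a + b + r + 1 by ring,
      Nat.factorial_succ, Nat.factorial_succ]
    calc (a + r + 1) * (a + r).factorial * (b + r).factorial
        = (a + r + 1) * ((a + r).factorial * (b + r).factorial) := by ring
      _ ≤ (a + b + r + 1) * (r.factorial * (a + b + r).factorial) :=
        Nat.mul_le_mul (by omega) ih
      _ = _ := by ring

theorem neg_one_pow_mul_factorial_le {p q r : ℕ} (hr : Even p → r ≤ p ∧ r ≤ q) :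
    ((-1) ^ p * p.factorial * q.factorial : ℝ) ≤ (r.factorial * (p + q - r).factorial : ℕ) := by
  rcases Nat.even_or_odd p with hp | hp
  · obtain ⟨h1, h2⟩ := hr hp
    obtain ⟨a, rfl⟩ := Nat.exists_eq_add_of_le' h1
    obtain ⟨b, rfl⟩ := Nat.exists_eq_add_of_le' h2
    rw [hp.neg_one_pow, one_mul, show a + r + (b + r) - r = a + b + r by omega]
    exact_mod_cast factorial_mul_factorial_le r a b
  · rw [hp.neg_one_pow]
    exact le_trans (by simp only [neg_mul, one_mul, Left.neg_nonpos_iff]; positivity)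
      (Nat.cast_nonneg _)

/-- The values of a one-dimensional character of a finite group have absolute value one. -/
theorem FDRep.character_pow_orderOf_eq_one {G : Type*} [Group G] [Finite G] (V : FDRep ℂ G)
    (hV : V.character 1 = 1) (g : G) : V.character g ^ orderOf g = 1 := by
  rw [FDRep.char_one, Nat.cast_eq_one] at hV
  obtain ⟨v, hv, h⟩ := finrank_eq_one_iff'.1 hV
  obtain ⟨a, ha⟩ := h (V.ρ g v)
  have hg : V.ρ g = a • 1 := by
    ext w
    obtain ⟨b, rfl⟩ := h w
    rw [map_smul, ← ha, smul_comm]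
    rfl
  have hchar : V.character g = a := by
    rw [FDRep.character, hg, map_smul, LinearMap.trace_one, hV]
    simp
  have hpow : V.ρ (g ^ orderOf g) v = a ^ orderOf g • v := by
    rw [map_pow, hg, smul_pow, one_pow]
    rfl
  rw [pow_orderOf_eq_one, map_one, Module.End.one_apply] at hpow
  rw [hchar]
  refine smul_left_injective ℂ hv ?_
  simp only
  rw [← hpow, one_smul]

variable {n : ℕ} {h : Perm (Fin n)}

theorem isGreatest_character_ratio (hn : 4 < n) (hh : h ∈ cyclesOn Finset.univ) {r : ℕ}
    (hr0 : 0 < r) (hrn : r < n - 1)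
    (hr : ∀ p q, 0 < p → 0 < q → p + q = n - 1 → Even p → r ≤ p ∧ r ≤ q)
    (hex : ∃ (V : Type) (_ : AddCommGroup V) (_ : Module ℂ V) (_ : FiniteDimensional ℂ V)
      (ρ : Representation ℂ (Perm (Fin n)) V) (v : V), v ≠ 0 ∧
      sumCycles ρ v = (r.factorial * (n - 1 - r).factorial : ℂ) • v) :
    IsGreatest
      {t : ℝ | ∃ V : FDRep ℂ (Perm (Fin n)), CategoryTheory.Simple V ∧
        V.character 1 ≠ 1 ∧ V.character h / V.character 1 = (t : ℂ)}
      ((r.factorial * (n - 1 - r).factorial : ℕ) / ((n - 1).factorial : ℕ)) := by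
  have hpos : (0 : ℝ) < (n - 1).factorial := Nat.cast_pos.2 (Nat.factorial_pos _)
  constructor
  · obtain ⟨V, _, _, _, ρ, v, hv, hρ⟩ := hex
    obtain ⟨W, hW, hWh⟩ := exists_simple_of_sumCycles ρ (by omega) hv hρ hh
    refine ⟨W, hW, fun h1 => ?_, by rw [hWh]; push_cast; rfl⟩
    have h2 := FDRep.character_pow_orderOf_eq_one W h1 h
    rw [h1, div_one] at hWh
    rw [hWh] at h2
    have h3 : ((r.factorial * (n - 1 - r).factorial : ℕ) / ((n - 1).factorial : ℕ) : ℝ) ^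
        orderOf h = 1 := by
      rw [← Complex.ofReal_inj]
      push_cast
      exact h2
    have h4 : r.factorial * (n - 1 - r).factorial < (n - 1).factorial := by
      rw [← Nat.choose_mul_factorial_mul_factorial hrn.le, mul_assoc]
      refine lt_mul_of_one_lt_left (by positivity) ?_
      have h5 := Nat.choose_pos hrn.le
      have h6 : (n - 1).choose r ≠ 1 := by
        rw [Ne, Nat.choose_eq_one_iff]
        omega
      omega
    refine (pow_lt_one₀ (by positivity) ?_ (orderOf_pos h).ne').ne h3
    rw [div_lt_one hpos]
    exact_mod_cast h4
  · rintro t ⟨V, hV, hV1, ht⟩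
    rw [FDRep.char_one, Ne, Nat.cast_eq_one] at hV1
    have := FDRep.nontrivial_of_simple V
    obtain ⟨a, ha, ha'⟩ := exists_sumCycles_eq_smul V (by omega) hV1
    have h1 : V.character h / V.character 1 = a / (n - 1).factorial :=
      character_div_eq_of_sumCycles V.ρ (by omega) hh ha
    rw [ht] at h1
    rw [le_div_iff₀ hpos]
    have h2 : ((t * (n - 1).factorial : ℝ) : ℂ) = a := by
      push_cast
      rw [h1, div_mul_cancel₀]
      exact_mod_cast hpos.ne'
    rcases ha' with rfl | ⟨p, q, hp, hq, hpq, rfl⟩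
    · rw [Complex.ofReal_eq_zero.1 h2]
      exact Nat.cast_nonneg _
    · have h3 : t * (n - 1).factorial = (-1) ^ p * p.factorial * q.factorial := by
        exact_mod_cast h2
      rw [h3, ← hpq]
      exact neg_one_pow_mul_factorial_le (hr p q hp hq hpq)

end ratio

/-- Let `n > 4` and let `h ∈ S_n` be an `n`-cycle with conjugacy class `H`,
`|H| = (n-1)!`.  (1) If `n` is odd, the maximum of `χ(h)/χ(1)` over irreducible complex
characters `χ` of `S_n` with `χ(1) ≠ 1` equals `2/((n-1)(n-2))`, and the corresponding
eigenvalue `|H|·2/((n-1)(n-2))` of `H⁺` equals `2·(n-3)!`.  (2) If `n` is even, this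
maximum equals `1/(n-1)` and the corresponding eigenvalue equals `(n-2)!`. -/
theorem stmt11 (n : ℕ) (hn : 4 < n) (h : Perm (Fin n))
    (hcyc : h.IsCycle) (hsupp : h.support.card = n) :
    (Odd n →
      IsGreatest
        {t : ℝ | ∃ V : FDRep ℂ (Perm (Fin n)), CategoryTheory.Simple V ∧
          V.character 1 ≠ 1 ∧ V.character h / V.character 1 = (t : ℂ)}
        (2 / (((n : ℝ) - 1) * ((n : ℝ) - 2))) ∧
      ((n - 1).factorial : ℝ) * (2 / (((n : ℝ) - 1) * ((n : ℝ) - 2))) =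
        ((2 * (n - 3).factorial : ℕ) : ℝ)) ∧
    (Even n →
      IsGreatest
        {t : ℝ | ∃ V : FDRep ℂ (Perm (Fin n)), CategoryTheory.Simple V ∧
          V.character 1 ≠ 1 ∧ V.character h / V.character 1 = (t : ℂ)}
        (1 / ((n : ℝ) - 1)) ∧
      ((n - 1).factorial : ℝ) * (1 / ((n : ℝ) - 1)) = (((n - 2).factorial : ℕ) : ℝ)) := by
  have hh : h ∈ cyclesOn Finset.univ :=
    mem_cyclesOn.2 ⟨hcyc, (Finset.card_eq_iff_eq_univ _).1 (by rw [hsupp, Fintype.card_fin])⟩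
  refine ⟨fun hodd => ?_, fun heven => ?_⟩
  · obtain ⟨m, rfl⟩ : ∃ m, n = m + 3 := ⟨n - 3, by omega⟩
    have hfac : ((m + 3 - 1).factorial : ℝ) = (m + 2) * (m + 1) * m.factorial := by
      rw [show m + 3 - 1 = m + 1 + 1 by omega, Nat.factorial_succ, Nat.factorial_succ]
      push_cast; ring
    have hm : (m.factorial : ℝ) ≠ 0 := Nat.cast_ne_zero.2 (Nat.factorial_ne_zero _)
    have hm1 : (m + 1 : ℝ) ≠ 0 := by positivity
    have hm2 : (m + 2 : ℝ) ≠ 0 := by positivity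
    have hsub1 : ((m + 3 : ℕ) : ℝ) - 1 = m + 2 := by push_cast; ring
    have hsub2 : ((m + 3 : ℕ) : ℝ) - 2 = m + 1 := by push_cast; ring
    rw [hsub1, hsub2]
    refine ⟨?_, by rw [hfac]; push_cast [Nat.add_sub_cancel]; field_simp⟩
    have hmain := isGreatest_character_ratio hn hh (r := 2) (by omega) (by omega)
      (fun p q hp hq hpq hpe => by
        obtain ⟨a, ha⟩ := hpe
        obtain ⟨b, hb⟩ := hodd
        omega)
      (by simpa using exists_sumCycles_eq_two_mul_smul m)
    convert hmain using 1
    rw [hfac, show m + 3 - 1 - 2 = m by omega]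
    push_cast [Nat.factorial_two]
    field_simp
  · obtain ⟨m, rfl⟩ : ∃ m, n = m + 2 := ⟨n - 2, by omega⟩
    have hfac : ((m + 2 - 1).factorial : ℝ) = (m + 1) * m.factorial := by
      rw [show m + 2 - 1 = m + 1 by omega, Nat.factorial_succ]
      push_cast; ring
    have hm : (m.factorial : ℝ) ≠ 0 := Nat.cast_ne_zero.2 (Nat.factorial_ne_zero _)
    have hm1 : (m + 1 : ℝ) ≠ 0 := by positivity
    have hsub1 : ((m + 2 : ℕ) : ℝ) - 1 = m + 1 := by push_cast; ring
    rw [hsub1]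
    refine ⟨?_, by rw [hfac, Nat.add_sub_cancel]; field_simp⟩
    have hme : Even m := by simpa [Nat.even_add] using heven
    have hmain := isGreatest_character_ratio hn hh (r := 1) (by omega) (by omega)
      (fun p q hp hq _ _ => ⟨hp, hq⟩)
      (by simpa [hme.neg_one_pow] using exists_sumCycles_eq_neg_one_pow_smul m)
    convert hmain using 1
    rw [hfac, show m + 2 - 1 - 1 = m by omega]
    push_cast [Nat.factorial_one]
    field_simp
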